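/- arXiv:quant-ph/0604206 — 5 statements merged into one kernel-verified Lean document; each statement's English description precedes it below -/
import Mathlib

section
/- Let d ≥ 1, let x_1,…,x_n be nonnegative reals with Σ_j x_j = 1, let P_1,…,P_n be positive semidefinite d×d complex matrices and Q_1,…,Q_n be positive definite d×d complex matrices. Then the quantum relative entropy is jointly convex: H(Σ_j x_j P_j, Σ_j x_j Q_j) ≤ Σ_j x_j H(P_j, Q_j). -/
open Matrix MeasureTheory
open scoped Kronecker ComplexOrder

/-- Matrix logarithm via spectral decomposition of a Hermitian matrix, with the
convention `log 0 = 0` on the kernel (i.e. `log` is taken on the support). -/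
noncomputable def matLog {n : Type*} [Fintype n] [DecidableEq n] (A : Matrix n n ℂ) :
    Matrix n n ℂ := by
  classical
  exact if hA : A.IsHermitian then
    (hA.eigenvectorUnitary : Matrix n n ℂ) *
      Matrix.diagonal (fun i => (Real.log (hA.eigenvalues i) : ℂ)) *
      ((hA.eigenvectorUnitary : Matrix n n ℂ))ᴴ
  else 0

/-- Quantum relative entropy `H(P,Q) = Tr[P (log P - log Q)]`. -/
noncomputable def relEnt {n : Type*} [Fintype n] [DecidableEq n] (P Q : Matrix n n ℂ) : ℝ :=
  ((P * (matLog P - matLog Q)).trace).re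

/-- Von Neumann entropy `S(ρ) = -Tr[ρ log ρ]`. -/
noncomputable def vNEnt {n : Type*} [Fintype n] [DecidableEq n] (ρ : Matrix n n ℂ) : ℝ :=
  -((ρ * matLog ρ).trace).re

/-- Partial trace over the second tensor factor. -/
noncomputable def ptraceB {A B : Type*} [Fintype B] (M : Matrix (A × B) (A × B) ℂ) :
    Matrix A A ℂ :=
  Matrix.of fun a a' => ∑ b : B, M (a, b) (a', b)

lemma two_mul_re_sub_le (z w : ℂ) (p c : ℝ) (hc : 0 < c) :
    2 * p * (star z * w).re - c * Complex.normSq z ≤ Complex.normSq w * (p ^ 2 / c) := by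
  have h : Complex.normSq w * (p ^ 2 / c) - (2 * p * (star z * w).re - c * Complex.normSq z) =
      ((p * w.re - c * z.re) ^ 2 + (p * w.im - c * z.im) ^ 2) / c := by
    simp [Complex.normSq_apply]
    field_simp
    ring
  have : 0 ≤ ((p * w.re - c * z.re) ^ 2 + (p * w.im - c * z.im) ^ 2) / c := by positivity
  linarith

/-- A functional, linear in `(P, Q)`, whose supremum over `X` is
`⟨P, (R_Q + t L_P)⁻¹ P⟩` for the left and right multiplication operators `L_P`, `R_Q`. -/
noncomputable def quadFunctional {n : Type*} [Fintype n] (t : ℝ) (X P Q : Matrix n n ℂ) : ℝ :=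
  2 * (Xᴴ * P).trace.re - (X * Q * Xᴴ).trace.re - t * (Xᴴ * P * X).trace.re

lemma quadFunctional_sum {n ι : Type*} [Fintype n] [Fintype ι] (t : ℝ) (X : Matrix n n ℂ)
    (x : ι → ℝ) (P Q : ι → Matrix n n ℂ) :
    quadFunctional t X (∑ j, x j • P j) (∑ j, x j • Q j) =
      ∑ j, x j * quadFunctional t X (P j) (Q j) := by
  simp only [quadFunctional, Matrix.sum_mul, Matrix.mul_smul, Matrix.smul_mul,
    Matrix.trace_sum, Matrix.trace_smul, Complex.re_sum, Complex.smul_re, smul_eq_mul,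
    Finset.mul_sum, ← Finset.sum_sub_distrib]
  exact Finset.sum_congr rfl fun j _ => by ring

/-- Trace of a product of two spectrally decomposed matrices. -/
lemma trace_conj_diagonal_mul_conj_diagonal {n : Type*} [Fintype n] [DecidableEq n]
    (U V : Matrix n n ℂ) (a b : n → ℝ) :
    ((U * diagonal (fun i => (a i : ℂ)) * Uᴴ) *
        (V * diagonal (fun i => (b i : ℂ)) * Vᴴ)).trace.re =
      ∑ i, ∑ j, Complex.normSq ((Uᴴ * V) i j) * (a i * b j) := by
  have h : ((U * diagonal (fun i => (a i : ℂ)) * Uᴴ) *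
        (V * diagonal (fun i => (b i : ℂ)) * Vᴴ)).trace =
      (diagonal (fun i => (a i : ℂ)) * (Uᴴ * V) * diagonal (fun i => (b i : ℂ)) *
        (Uᴴ * V)ᴴ).trace := by
    rw [conjTranspose_mul, conjTranspose_conjTranspose]
    simp only [Matrix.mul_assoc]
    rw [trace_mul_comm U]
    simp only [Matrix.mul_assoc]
  rw [h]
  generalize Uᴴ * V = W
  simp only [trace, diag_apply, mul_apply (N := Wᴴ), mul_diagonal, diagonal_mul,
    conjTranspose_apply, Complex.re_sum]
  refine Finset.sum_congr rfl fun i _ => Finset.sum_congr rfl fun j _ => ?_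
  simp [Complex.normSq_apply]
  ring

/-- The quadratic functional in the eigenbases of its arguments. -/
lemma quadFunctional_conj_diagonal {n : Type*} [Fintype n] [DecidableEq n]
    (U V Y : Matrix n n ℂ) (hU : Uᴴ * U = 1) (hV : Vᴴ * V = 1) (p q : n → ℝ) (t : ℝ) :
    quadFunctional t (U * Y * Vᴴ) (U * diagonal (fun i => (p i : ℂ)) * Uᴴ)
        (V * diagonal (fun i => (q i : ℂ)) * Vᴴ) =
      ∑ i, ∑ j, (2 * p i * (star (Y i j) * (Uᴴ * V) i j).re -
        (q j + t * p i) * Complex.normSq (Y i j)) := by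
  have hU' (M : Matrix n n ℂ) : Uᴴ * (U * M) = M := by rw [← Matrix.mul_assoc, hU, Matrix.one_mul]
  have hV' (M : Matrix n n ℂ) : Vᴴ * (V * M) = M := by rw [← Matrix.mul_assoc, hV, Matrix.one_mul]
  have h₁ : ((U * Y * Vᴴ)ᴴ * (U * diagonal (fun i => (p i : ℂ)) * Uᴴ)).trace =
      (diagonal (fun i => (p i : ℂ)) * (Uᴴ * V) * Yᴴ).trace := by
    simp only [conjTranspose_mul, conjTranspose_conjTranspose, Matrix.mul_assoc, hU']
    rw [← Matrix.mul_assoc V, trace_mul_comm]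
    simp only [Matrix.mul_assoc]
  have h₂ : ((U * Y * Vᴴ) * (V * diagonal (fun i => (q i : ℂ)) * Vᴴ) * (U * Y * Vᴴ)ᴴ).trace =
      (Y * diagonal (fun i => (q i : ℂ)) * Yᴴ).trace := by
    simp only [conjTranspose_mul, conjTranspose_conjTranspose, Matrix.mul_assoc, hV']
    rw [trace_mul_comm]
    simp only [Matrix.mul_assoc, hU, Matrix.mul_one]
  have h₃ : ((U * Y * Vᴴ)ᴴ * (U * diagonal (fun i => (p i : ℂ)) * Uᴴ) * (U * Y * Vᴴ)).trace =
      (diagonal (fun i => (p i : ℂ)) * Y * Yᴴ).trace := by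
    simp only [conjTranspose_mul, conjTranspose_conjTranspose, Matrix.mul_assoc, hU']
    rw [trace_mul_comm]
    simp only [Matrix.mul_assoc, hV, Matrix.mul_one]
    rw [trace_mul_comm]
    simp only [Matrix.mul_assoc]
  rw [quadFunctional, h₁, h₂, h₃]
  generalize Uᴴ * V = W
  simp only [trace, diag_apply, mul_apply (N := Yᴴ), mul_diagonal, diagonal_mul,
    conjTranspose_apply, Complex.re_sum, Finset.mul_sum, ← Finset.sum_sub_distrib]
  refine Finset.sum_congr rfl fun i _ => Finset.sum_congr rfl fun j _ => ?_
  simp [Complex.normSq_apply]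
  ring

lemma two_mul_re_sub_eq (w : ℂ) (p c : ℝ) (hc : 0 < c) :
    2 * p * (star (((p / c : ℝ) : ℂ) * w) * w).re - c * Complex.normSq (((p / c : ℝ) : ℂ) * w) =
      Complex.normSq w * (p ^ 2 / c) := by
  simp only [Complex.normSq_apply, star_mul, Complex.star_def, Complex.conj_ofReal,
    Complex.mul_re, Complex.mul_im, Complex.ofReal_re, Complex.ofReal_im, Complex.conj_re,
    Complex.conj_im]
  field_simp
  ring

lemma Matrix.IsHermitian.eq_conj_diagonal_eigenvalues {n : Type*} [Fintype n] [DecidableEq n]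
    {A : Matrix n n ℂ} (hA : A.IsHermitian) :
    A = (hA.eigenvectorUnitary : Matrix n n ℂ) * diagonal (fun i => (hA.eigenvalues i : ℂ)) *
      (hA.eigenvectorUnitary : Matrix n n ℂ)ᴴ := by
  conv_lhs => rw [hA.spectral_theorem]
  rfl

/-- Joint spectral data of a pair `(P, Q)`: eigenvalues `p`, `q` and squared overlaps `w` of the
eigenvectors, which express the relative entropy and the maximum of the quadratic functional. -/
lemma exists_spectral_data {n : Type*} [Fintype n] [DecidableEq n] {P Q : Matrix n n ℂ}
    (hP : P.PosSemidef) (hQ : Q.PosDef) :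
    ∃ (w : n → n → ℝ) (p q : n → ℝ), (∀ i, 0 ≤ p i) ∧ (∀ j, 0 < q j) ∧
      relEnt P Q = ∑ i, ∑ j, w i j * (p i * (Real.log (p i) - Real.log (q j))) ∧
      P.trace.re = ∑ i, ∑ j, w i j * p i ∧
      ∀ t : ℝ, 0 ≤ t → IsGreatest (Set.range fun X => quadFunctional t X P Q)
        (∑ i, ∑ j, w i j * (p i ^ 2 / (q j + t * p i))) := by
  have hPU := hP.1.eq_conj_diagonal_eigenvalues
  have hQV := hQ.1.eq_conj_diagonal_eigenvalues
  have hLP : matLog P = _ := dif_pos hP.1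
  have hLQ : matLog Q = _ := dif_pos hQ.1
  have hU : (hP.1.eigenvectorUnitary : Matrix n n ℂ)ᴴ * hP.1.eigenvectorUnitary = 1 :=
    Unitary.coe_star_mul_self _
  have hU' : (hP.1.eigenvectorUnitary : Matrix n n ℂ) *
      (hP.1.eigenvectorUnitary : Matrix n n ℂ)ᴴ = 1 := Unitary.coe_mul_star_self _
  have hV : (hQ.1.eigenvectorUnitary : Matrix n n ℂ)ᴴ * hQ.1.eigenvectorUnitary = 1 :=
    Unitary.coe_star_mul_self _
  have hV' : (hQ.1.eigenvectorUnitary : Matrix n n ℂ) *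
      (hQ.1.eigenvectorUnitary : Matrix n n ℂ)ᴴ = 1 := Unitary.coe_mul_star_self _
  have hp := hP.eigenvalues_nonneg
  have hq := hQ.eigenvalues_pos
  generalize (hP.1.eigenvectorUnitary : Matrix n n ℂ) = U at *
  generalize (hQ.1.eigenvectorUnitary : Matrix n n ℂ) = V at *
  generalize hP.1.eigenvalues = p at *
  generalize hQ.1.eigenvalues = q at *
  -- sums over the first eigenbasis alone, rewritten as double sums
  have hdouble (a b : n → ℝ) :
      ((U * diagonal (fun i => (a i : ℂ)) * Uᴴ) *
        (U * diagonal (fun i => (b i : ℂ)) * Uᴴ)).trace.re =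
      ∑ i, ∑ j, Complex.normSq ((Uᴴ * V) i j) * (a i * b i) := by
    have h := trace_conj_diagonal_mul_conj_diagonal U V (fun i => a i * b i) (fun _ => 1)
    simp only [mul_one] at h
    rw [← h]
    have hone : V * diagonal (fun _ => ((1 : ℝ) : ℂ)) * Vᴴ = 1 := by
      simp [hV']
    rw [hone, Matrix.mul_one]
    congr 2
    have hUM (M : Matrix n n ℂ) : Uᴴ * (U * M) = M := by
      rw [← Matrix.mul_assoc, hU, Matrix.one_mul]
    simp only [Matrix.mul_assoc, hUM]
    rw [← Matrix.mul_assoc (diagonal _) (diagonal _), diagonal_mul_diagonal]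
    simp
  refine ⟨fun i j => Complex.normSq ((Uᴴ * V) i j), p, q, hp, hq, ?_, ?_, fun t ht => ⟨?_, ?_⟩⟩
  · rw [relEnt, hLP, hLQ, Matrix.mul_sub, trace_sub, Complex.sub_re, hPU, hdouble,
      trace_conj_diagonal_mul_conj_diagonal]
    simp only [← Finset.sum_sub_distrib]
    exact Finset.sum_congr rfl fun i _ => Finset.sum_congr rfl fun j _ => by ring
  · have h := hdouble p fun _ => 1
    simp only [mul_one] at h
    rw [← h, ← hPU]
    simp [hU']
  · refine ⟨U * of (fun i j => ((p i / (q j + t * p i) : ℝ) : ℂ) * (Uᴴ * V) i j) * Vᴴ, ?_⟩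
    dsimp only
    rw [hPU, hQV, quadFunctional_conj_diagonal U V _ hU hV]
    refine Finset.sum_congr rfl fun i _ => Finset.sum_congr rfl fun j _ => ?_
    exact two_mul_re_sub_eq _ _ _ (add_pos_of_pos_of_nonneg (hq j) (mul_nonneg ht (hp i)))
  · rintro _ ⟨X, rfl⟩
    have hX : X = U * (Uᴴ * X * V) * Vᴴ := by
      rw [Matrix.mul_assoc, Matrix.mul_assoc, Matrix.mul_assoc, hV', Matrix.mul_one,
        ← Matrix.mul_assoc, hU', Matrix.one_mul]
    dsimp only
    rw [hX, hPU, hQV, quadFunctional_conj_diagonal U V _ hU hV]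
    refine Finset.sum_le_sum fun i _ => Finset.sum_le_sum fun j _ => ?_
    exact two_mul_re_sub_le _ _ _ _ (add_pos_of_pos_of_nonneg (hq j) (mul_nonneg ht (hp i)))

lemma hasDerivAt_mul_log_add_mul {p q t : ℝ} (h : 0 < q + t * p) :
    HasDerivAt (fun s => p * (Real.log (q + s * p) - Real.log q)) (p ^ 2 / (q + t * p)) t := by
  have h₁ : HasDerivAt (fun s : ℝ => q + s * p) p t := by
    simpa using ((hasDerivAt_id t).mul_const p).const_add q
  exact (((h₁.log h.ne').sub_const (Real.log q)).const_mul p).congr_deriv (by ring)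

lemma tendsto_mul_log_add_mul_sub {p q : ℝ} (hp : 0 ≤ p) (hq : 0 < q) :
    Filter.Tendsto (fun t => p * (Real.log (q + t * p) - Real.log q) - p * Real.log t)
      Filter.atTop (nhds (p * (Real.log p - Real.log q))) := by
  rcases hp.eq_or_lt with rfl | hp
  · simp
  have h₁ : Filter.Tendsto (fun t : ℝ => q / t + p) Filter.atTop (nhds p) := by
    simpa using (tendsto_const_nhds.div_atTop Filter.tendsto_id).add_const p
  have h₂ := ((h₁.log hp.ne').sub_const (Real.log q)).const_mul p
  refine h₂.congr' ?_
  filter_upwards [Filter.eventually_gt_atTop 0] with t ht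
  have : q / t + p = (q + t * p) / t := by field_simp
  rw [this, Real.log_div (by positivity) ht.ne']
  ring

/-- Antiderivative of the maximum of the quadratic functional, with the limit that recovers the
relative entropy. -/
lemma exists_primitive {n : Type*} [Fintype n] [DecidableEq n] {P Q : Matrix n n ℂ}
    (hP : P.PosSemidef) (hQ : Q.PosDef) :
    ∃ F G : ℝ → ℝ, F 0 = 0 ∧ (∀ t, 0 ≤ t → HasDerivAt F (G t) t) ∧
      (∀ t, 0 ≤ t → IsGreatest (Set.range fun X => quadFunctional t X P Q) (G t)) ∧
      Filter.Tendsto (fun t => F t - P.trace.re * Real.log t) Filter.atTop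
        (nhds (relEnt P Q)) := by
  obtain ⟨w, p, q, hp, hq, hrel, htr, hG⟩ := exists_spectral_data hP hQ
  refine ⟨fun t => ∑ i, ∑ j, w i j * (p i * (Real.log (q j + t * p i) - Real.log (q j))), _,
    by simp, fun t ht => ?_, hG, ?_⟩
  · refine HasDerivAt.fun_sum fun i _ => HasDerivAt.fun_sum fun j _ => ?_
    exact (hasDerivAt_mul_log_add_mul
      (add_pos_of_pos_of_nonneg (hq j) (mul_nonneg ht (hp i)))).const_mul _
  · rw [hrel, htr]
    simp only [Finset.sum_mul, ← Finset.sum_sub_distrib, mul_assoc, ← mul_sub]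
    refine tendsto_finsetSum _ fun i _ => tendsto_finsetSum _ fun j _ => ?_
    simpa only [mul_sub] using (tendsto_mul_log_add_mul_sub (hp i) (hq j)).const_mul (w i j)

lemma Matrix.PosDef.sum_smul {n ι : Type*} [Fintype ι] {x : ι → ℝ} (hx : ∀ j, 0 ≤ x j)
    (hx1 : ∑ j, x j = 1) {Q : ι → Matrix n n ℂ} (hQ : ∀ j, (Q j).PosDef) :
    (∑ j, x j • Q j).PosDef := by
  classical
  obtain ⟨k, hk⟩ : ∃ k, 0 < x k := by
    by_contra! h
    have := Finset.sum_nonpos fun j (_ : j ∈ Finset.univ) => h j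
    linarith
  rw [← Finset.add_sum_erase _ _ (Finset.mem_univ k)]
  exact ((hQ k).smul hk).add_posSemidef
    (Matrix.posSemidef_sum _ fun j _ => (hQ j).posSemidef.smul (hx j))

/-- Joint convexity of quantum relative entropy. -/
theorem relEnt_joint_convex {d n : ℕ} (hd : 1 ≤ d)
    (x : Fin n → ℝ) (hx : ∀ j, 0 ≤ x j) (hx1 : ∑ j, x j = 1)
    (P Q : Fin n → Matrix (Fin d) (Fin d) ℂ)
    (hP : ∀ j, (P j).PosSemidef) (hQ : ∀ j, (Q j).PosDef) :
    relEnt (∑ j, x j • P j) (∑ j, x j • Q j) ≤ ∑ j, x j * relEnt (P j) (Q j) := by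
  have hPs : (∑ j, x j • P j).PosSemidef :=
    Matrix.posSemidef_sum _ fun j _ => (hP j).smul (hx j)
  obtain ⟨F₀, G₀, hF₀, hd₀, hG₀, hlim₀⟩ := exists_primitive hPs (Matrix.PosDef.sum_smul hx hx1 hQ)
  choose F G hF hdF hG hlim using fun j => exists_primitive (hP j) (hQ j)
  have hder (t : ℝ) (ht : 0 ≤ t) :
      HasDerivAt (fun s => ∑ j, x j * F j s - F₀ s) (∑ j, x j * G j t - G₀ t) t :=
    (HasDerivAt.fun_sum fun j _ => (hdF j t ht).const_mul (x j)).sub (hd₀ t ht)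
  have hderiv_nonneg (t : ℝ) (ht : 0 ≤ t) : 0 ≤ ∑ j, x j * G j t - G₀ t := by
    obtain ⟨X, hX⟩ := (hG₀ t ht).1
    rw [sub_nonneg, ← hX]
    dsimp only
    rw [quadFunctional_sum]
    exact Finset.sum_le_sum fun j _ =>
      mul_le_mul_of_nonneg_left ((hG j t ht).2 ⟨X, rfl⟩) (hx j)
  have hmono : MonotoneOn (fun s => ∑ j, x j * F j s - F₀ s) (Set.Ici 0) := by
    refine monotoneOn_of_hasDerivWithinAt_nonneg (convex_Ici 0)
      (fun t ht => (hder t ht).continuousAt.continuousWithinAt)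
      (fun t ht => (hder t (interior_subset ht)).hasDerivWithinAt)
      fun t ht => hderiv_nonneg t (interior_subset ht)
  have hle : ∀ᶠ t in Filter.atTop,
      F₀ t - (∑ j, x j • P j).trace.re * Real.log t ≤
        ∑ j, x j * (F j t - (P j).trace.re * Real.log t) := by
    filter_upwards [Filter.eventually_ge_atTop 0] with t ht
    have h := hmono Set.self_mem_Ici ht ht
    simp only [hF, hF₀, mul_zero, Finset.sum_const_zero, sub_zero] at h
    simp only [Matrix.trace_sum, Matrix.trace_smul, Complex.re_sum, Complex.smul_re, smul_eq_mul,
      mul_sub, Finset.sum_sub_distrib, Finset.sum_mul, mul_assoc]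
    linarith
  exact le_of_tendsto_of_tendsto hlim₀
    (tendsto_finsetSum _ fun j _ => (hlim j).const_mul (x j)) hle
end

section
/- Let t ≥ 0, let P_1,…,P_n and Q_1,…,Q_n be positive definite d×d complex matrices, and let A_1,…,A_n be arbitrary d×d complex matrices. Then Tr[(Σ_j A_j)† · (L_{Σ_j P_j} + tR_{Σ_j Q_j})^{−1}(Σ_j A_j)] ≤ Σ_j Tr[A_j† · (L_{P_j} + tR_{Q_j})^{−1}(A_j)]. Equivalently, the map (A,P,Q) ↦ Tr[A† (L_P + tR_Q)^{−1}(A)] is jointly convex in (A,P,Q). -/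
open Matrix MeasureTheory
open scoped Kronecker ComplexOrder

/-- The map `L_P + t R_Q : X ↦ P X + t X Q` is symmetric for the real trace inner product
when `P` and `Q` are Hermitian and `t` is real. -/
theorem re_trace_conjTranspose_mul_add_smul_mul_comm {m : Type*} [Fintype m] (t : ℝ)
    {P Q : Matrix m m ℂ} (hP : P.IsHermitian) (hQ : Q.IsHermitian) (X Y : Matrix m m ℂ) :
    ((P * X + (t : ℂ) • (X * Q))ᴴ * Y).trace.re =
      ((P * Y + (t : ℂ) • (Y * Q))ᴴ * X).trace.re := by
  have h : ((P * X + (t : ℂ) • (X * Q))ᴴ * Y).trace =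
      (((P * Y + (t : ℂ) • (Y * Q))ᴴ * X)ᴴ).trace := by
    simp only [conjTranspose_mul, conjTranspose_add, conjTranspose_smul,
      conjTranspose_conjTranspose, hP.eq, hQ.eq, Matrix.add_mul, Matrix.smul_mul,
      trace_add, trace_smul, Complex.star_def, Complex.conj_ofReal,
      Matrix.mul_assoc]
    rw [trace_mul_comm Q, Matrix.mul_assoc]
  rw [h, trace_conjTranspose, Complex.star_def, Complex.conj_re]

/-- The map `L_P + t R_Q : X ↦ P X + t X Q` is positive for the real trace inner product
when `P` and `Q` are positive semidefinite and `t ≥ 0`. -/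
theorem re_trace_conjTranspose_mul_add_smul_mul_nonneg {m : Type*} [Fintype m] {t : ℝ}
    (ht : 0 ≤ t) {P Q : Matrix m m ℂ} (hP : P.PosSemidef) (hQ : Q.PosSemidef)
    (X : Matrix m m ℂ) :
    0 ≤ ((P * X + (t : ℂ) • (X * Q))ᴴ * X).trace.re := by
  have h : ((P * X + (t : ℂ) • (X * Q))ᴴ * X).trace =
      (Xᴴ * P * X).trace + (t : ℂ) * (X * Q * Xᴴ).trace := by
    simp only [conjTranspose_mul, conjTranspose_add, conjTranspose_smul, hP.isHermitian.eq,
      hQ.isHermitian.eq, Matrix.add_mul, Matrix.smul_mul, trace_add, trace_smul,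
      Complex.star_def, Complex.conj_ofReal, smul_eq_mul]
    rw [trace_mul_cycle Q]
  have hPX := (Complex.le_def.1 (hP.conjTranspose_mul_mul_same X).trace_nonneg).1
  have hQX := (Complex.le_def.1 (hQ.mul_mul_conjTranspose_same X).trace_nonneg).1
  rw [h, Complex.add_re, Complex.re_ofReal_mul]
  exact add_nonneg hPX (mul_nonneg ht hQX)

/-- Joint convexity (in subadditive form) of `(A,P,Q) ↦ Tr[A† (L_P + t R_Q)⁻¹ (A)]`:
if `(L_{P_j} + t R_{Q_j})(B_j) = A_j` and `(L_{∑ P_j} + t R_{∑ Q_j})(B₀) = ∑ A_j`, then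
`Tr[(∑ A_j)† B₀] ≤ ∑ Tr[A_j† B_j]`. -/
theorem trace_inv_map_joint_convex {d n : ℕ} (t : ℝ) (ht : 0 ≤ t)
    (P Q A : Fin n → Matrix (Fin d) (Fin d) ℂ)
    (hP : ∀ j, (P j).PosDef) (hQ : ∀ j, (Q j).PosDef)
    (B : Fin n → Matrix (Fin d) (Fin d) ℂ)
    (hB : ∀ j, P j * B j + (t : ℂ) • (B j * Q j) = A j)
    (B0 : Matrix (Fin d) (Fin d) ℂ)
    (hB0 : (∑ j, P j) * B0 + (t : ℂ) • (B0 * ∑ j, Q j) = ∑ j, A j) :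
    ((∑ j, A j)ᴴ * B0).trace.re ≤ ∑ j, ((A j)ᴴ * B j).trace.re := by
  have key : ∀ j, 2 * ((A j)ᴴ * B0).trace.re -
      ((P j * B0 + (t : ℂ) • (B0 * Q j))ᴴ * B0).trace.re ≤ ((A j)ᴴ * B j).trace.re := by
    intro j
    have hpos := re_trace_conjTranspose_mul_add_smul_mul_nonneg ht (hP j).posSemidef
      (hQ j).posSemidef (B j - B0)
    have hsymm := re_trace_conjTranspose_mul_add_smul_mul_comm t (hP j).isHermitian
      (hQ j).isHermitian (B j) B0
    have hsub : P j * (B j - B0) + (t : ℂ) • ((B j - B0) * Q j) =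
        A j - (P j * B0 + (t : ℂ) • (B0 * Q j)) := by
      rw [← hB j, Matrix.mul_sub, Matrix.sub_mul, smul_sub]
      abel
    rw [hB j] at hsymm
    rw [hsub, conjTranspose_sub, Matrix.sub_mul, Matrix.mul_sub, Matrix.mul_sub] at hpos
    simp only [trace_sub, Complex.sub_re] at hpos
    linarith
  have hsumA : ((∑ j, A j)ᴴ * B0).trace.re = ∑ j, ((A j)ᴴ * B0).trace.re := by
    rw [conjTranspose_sum, Matrix.sum_mul, trace_sum, Complex.re_sum]
  have hsumM : ((∑ j, A j)ᴴ * B0).trace.re =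
      ∑ j, ((P j * B0 + (t : ℂ) • (B0 * Q j))ᴴ * B0).trace.re := by
    rw [← Complex.re_sum, ← trace_sum, ← Matrix.sum_mul, ← conjTranspose_sum,
      Finset.sum_add_distrib, ← Finset.smul_sum, ← Matrix.sum_mul, ← Matrix.mul_sum, hB0]
  have hsum := Finset.sum_le_sum fun j (_ : j ∈ Finset.univ) => key j
  rw [Finset.sum_sub_distrib, ← Finset.mul_sum, ← hsumA, ← hsumM] at hsum
  linarith
end

section
/- For every real number w > 0, one has −log w = (1−w) + ∫₀^∞ (w−1)²/(w+t) · (1+t)^{−2} dt. -/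
open Matrix MeasureTheory
open scoped Kronecker ComplexOrder

/-- `-log w = (1-w) + ∫₀^∞ (w-1)²/(w+t) · (1+t)⁻² dt` for `w > 0`. -/
theorem neg_log_eq_integral' (w : ℝ) (hw : 0 < w) :
    -Real.log w = (1 - w) + ∫ t in Set.Ioi (0:ℝ), (w - 1) ^ 2 / (w + t) * ((1 + t) ^ 2)⁻¹ := by
  have hlim : Filter.Tendsto (fun t : ℝ => (w - 1) / (1 + t)) Filter.atTop (nhds 0) :=
    (Filter.tendsto_atTop_add_const_left _ 1 Filter.tendsto_id).const_div_atTop _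
  -- the antiderivative is `log (w + t) - log (1 + t) - (w - 1) / (1 + t)`
  have hG : Filter.Tendsto
      (fun t : ℝ => Real.log (w + t) - Real.log (1 + t) - (w - 1) / (1 + t))
      Filter.atTop (nhds 0) := by
    have hlog : Filter.Tendsto (fun t : ℝ => Real.log (1 + (w - 1) / (1 + t)))
        Filter.atTop (nhds 0) := by
      simpa using (hlim.const_add 1).log (by norm_num)
    have hsub := hlog.sub hlim
    rw [sub_zero] at hsub
    refine hsub.congr' ?_
    filter_upwards [Filter.eventually_ge_atTop 0] with t ht
    have h1 : 1 + t ≠ 0 := by positivity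
    have h2 : w + t ≠ 0 := by positivity
    rw [← Real.log_div h2 h1]
    congr 2
    field_simp
    ring
  have hint := integral_Ioi_of_hasDerivAt_of_nonneg' (a := 0)
    (g' := fun t : ℝ => (w - 1) ^ 2 / (w + t) * ((1 + t) ^ 2)⁻¹) ?_ ?_ hG
  · rw [hint]
    simp
    ring
  · intro t ht
    have ht0 : (0 : ℝ) ≤ t := ht
    have h1 : 1 + t ≠ 0 := by positivity
    have h2 : w + t ≠ 0 := by positivity
    have hd1 := (hasDerivAt_id' t).const_add 1
    have hd2 := (hasDerivAt_id' t).const_add w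
    refine (((hd2.log h2).sub (hd1.log h1)).sub
      ((hasDerivAt_const t (w - 1)).div hd1 h1)).congr_deriv ?_
    field_simp
    ring
  · intro t ht
    have ht0 : (0 : ℝ) < t := ht
    positivity
end

section
/- The conditional entropy is concave: if ρ and σ are density matrices indexed by (A×B)×(A×B) and x ∈ [0,1], then, writing τ = xρ + (1−x)σ, S(τ) − S(Tr_B τ) ≥ x[S(ρ) − S(Tr_B ρ)] + (1−x)[S(σ) − S(Tr_B σ)]. -/
open Matrix MeasureTheory
open scoped Kronecker ComplexOrder

open Filter Topology Finset

/-- The functional `W ↦ 2 Re Tr[PW] - Re Tr[WQWᴴ] - t Re Tr[WᴴPW]`. It is additive in `(P, Q)`, and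
its supremum over `W` is the value of the quadratic form of the inverse of `X ↦ tPX + XQ` at `P`. -/
noncomputable def quadVar {n : Type*} [Fintype n] (P Q : Matrix n n ℂ) (t : ℝ)
    (W : Matrix n n ℂ) : ℝ :=
  2 * (P * W).trace.re - (W * Q * Wᴴ).trace.re - t * (Wᴴ * P * W).trace.re

section Spectral

variable {n : Type*} [Fintype n]

lemma quadVar_convexComb (P₁ Q₁ P₂ Q₂ : Matrix n n ℂ) (t x y : ℝ) (W : Matrix n n ℂ) :
    quadVar (x • P₁ + y • P₂) (x • Q₁ + y • Q₂) t W =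
      x * quadVar P₁ Q₁ t W + y * quadVar P₂ Q₂ t W := by
  simp only [quadVar, Matrix.add_mul, Matrix.mul_add, Matrix.smul_mul, Matrix.mul_smul,
    trace_add, trace_smul, Complex.add_re, Complex.smul_re, smul_eq_mul]
  ring

variable [DecidableEq n]

lemma Matrix.IsHermitian.eq_eigenvectorUnitary_mul_diagonal_mul {A : Matrix n n ℂ}
    (hA : A.IsHermitian) :
    A = (hA.eigenvectorUnitary : Matrix n n ℂ) * diagonal (fun i => (hA.eigenvalues i : ℂ)) *
      (hA.eigenvectorUnitary : Matrix n n ℂ)ᴴ := by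
  conv_lhs => rw [hA.spectral_theorem]
  rfl

lemma vNEnt_eq_sum_eigenvalues {A : Matrix n n ℂ} (hA : A.IsHermitian) :
    vNEnt A = -∑ i, hA.eigenvalues i * Real.log (hA.eigenvalues i) := by
  have hU : (hA.eigenvectorUnitary : Matrix n n ℂ)ᴴ * hA.eigenvectorUnitary = 1 :=
    Unitary.coe_star_mul_self hA.eigenvectorUnitary
  have hlog : A * matLog A = (hA.eigenvectorUnitary : Matrix n n ℂ) *
      diagonal (fun i => (hA.eigenvalues i * Real.log (hA.eigenvalues i) : ℂ)) *
      (hA.eigenvectorUnitary : Matrix n n ℂ)ᴴ := by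
    rw [matLog, dif_pos hA]
    nth_rw 1 [hA.eq_eigenvectorUnitary_mul_diagonal_mul]
    simp only [Matrix.mul_assoc]
    rw [← Matrix.mul_assoc _ᴴ (hA.eigenvectorUnitary : Matrix n n ℂ), hU, Matrix.one_mul,
      ← Matrix.mul_assoc (diagonal _) (diagonal _), diagonal_mul_diagonal]
  rw [vNEnt, hlog, trace_mul_comm, ← Matrix.mul_assoc, hU, Matrix.one_mul, trace_diagonal]
  simp only [← Complex.ofReal_mul, Complex.re_sum, Complex.ofReal_re]

lemma trace_diagonal_mul_mul_conjTranspose (p : n → ℝ) (w u : Matrix n n ℂ) :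
    (diagonal (fun i => (p i : ℂ)) * w * uᴴ).trace.re =
      ∑ ij : n × n, p ij.1 * (w ij.1 ij.2 * star (u ij.1 ij.2)).re := by
  simp only [trace, diag_apply, Matrix.mul_apply (M := _ * w), diagonal_mul, conjTranspose_apply,
    Complex.re_sum, Fintype.sum_prod_type]
  simp only [mul_assoc, Complex.re_ofReal_mul]

lemma trace_mul_diagonal_mul_conjTranspose (q : n → ℝ) (w : Matrix n n ℂ) :
    (w * diagonal (fun i => (q i : ℂ)) * wᴴ).trace.re =
      ∑ ij : n × n, q ij.2 * Complex.normSq (w ij.1 ij.2) := by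
  simp only [trace, diag_apply, Matrix.mul_apply (M := w * _), mul_diagonal, conjTranspose_apply,
    Complex.re_sum, Fintype.sum_prod_type]
  refine sum_congr rfl fun i _ => sum_congr rfl fun j _ => ?_
  simp [Complex.normSq_apply]
  ring

lemma quadVar_eq_sum {P Q U V : Matrix n n ℂ} {p q : n → ℝ} (hU : Uᴴ * U = 1) (hV : Vᴴ * V = 1)
    (hP : P = U * diagonal (fun i => (p i : ℂ)) * Uᴴ)
    (hQ : Q = V * diagonal (fun i => (q i : ℂ)) * Vᴴ) (t : ℝ) (w : Matrix n n ℂ) :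
    quadVar P Q t (U * w * Vᴴ) = ∑ ij : n × n,
      (2 * (p ij.1 * (w ij.1 ij.2 * star ((Uᴴ * V) ij.1 ij.2)).re) -
        (q ij.2 + t * p ij.1) * Complex.normSq (w ij.1 ij.2)) := by
  have cancelU (X : Matrix n n ℂ) : Uᴴ * (U * X) = X := by
    rw [← Matrix.mul_assoc, hU, Matrix.one_mul]
  have cancelV (X : Matrix n n ℂ) : Vᴴ * (V * X) = X := by
    rw [← Matrix.mul_assoc, hV, Matrix.one_mul]
  have h₁ : (P * (U * w * Vᴴ)).trace =
      (diagonal (fun i => (p i : ℂ)) * w * (Uᴴ * V)ᴴ).trace := by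
    rw [hP, conjTranspose_mul, conjTranspose_conjTranspose]
    simp only [Matrix.mul_assoc]
    rw [trace_mul_comm]
    simp only [Matrix.mul_assoc, cancelU]
  have h₂ : ((U * w * Vᴴ) * Q * (U * w * Vᴴ)ᴴ).trace =
      (w * diagonal (fun i => (q i : ℂ)) * wᴴ).trace := by
    rw [hQ]
    simp only [conjTranspose_mul, conjTranspose_conjTranspose, Matrix.mul_assoc, cancelV]
    rw [trace_mul_comm]
    simp only [Matrix.mul_assoc, hU, Matrix.mul_one]
  have h₃ : ((U * w * Vᴴ)ᴴ * P * (U * w * Vᴴ)).trace =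
      (diagonal (fun i => (p i : ℂ)) * w * wᴴ).trace := by
    rw [hP]
    simp only [conjTranspose_mul, conjTranspose_conjTranspose, Matrix.mul_assoc, cancelU]
    rw [trace_mul_comm]
    simp only [Matrix.mul_assoc, hV, Matrix.mul_one]
    rw [trace_mul_comm]
    simp only [Matrix.mul_assoc]
  rw [quadVar, h₁, h₂, h₃, trace_diagonal_mul_mul_conjTranspose,
    trace_mul_diagonal_mul_conjTranspose, trace_diagonal_mul_mul_conjTranspose, mul_sum, mul_sum,
    ← sum_sub_distrib, ← sum_sub_distrib]
  refine sum_congr rfl fun ij _ => ?_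
  simp [Complex.normSq_apply]
  ring

lemma two_mul_re_sub_normSq_le {p s : ℝ} (hs : 0 ≤ s) (hsp : s = 0 → p = 0) (w u : ℂ) :
    2 * (p * (w * star u).re) - s * Complex.normSq w ≤ Complex.normSq u * (p ^ 2 / s) := by
  rcases hs.eq_or_lt with rfl | hs
  · simp [hsp rfl]
  · rw [← mul_div_assoc, le_div_iff₀ hs]
    simp [Complex.normSq_apply]
    nlinarith [sq_nonneg (s * w.re - p * u.re), sq_nonneg (s * w.im - p * u.im)]

lemma two_mul_re_sub_normSq_eq {p s : ℝ} (hsp : s = 0 → p = 0) (u : ℂ) :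
    2 * (p * ((p / s : ℝ) * u * star u).re) - s * Complex.normSq ((p / s : ℝ) * u) =
      Complex.normSq u * (p ^ 2 / s) := by
  by_cases hs : s = 0
  · simp [hsp hs]
  · rw [Complex.normSq_mul, Complex.normSq_ofReal, mul_assoc, Complex.re_ofReal_mul]
    simp [Complex.normSq_apply]
    field_simp
    ring

lemma isGreatest_quadVar {P Q U V : Matrix n n ℂ} {p q : n → ℝ} (hU : Uᴴ * U = 1)
    (hV : Vᴴ * V = 1) (hP : P = U * diagonal (fun i => (p i : ℂ)) * Uᴴ)
    (hQ : Q = V * diagonal (fun i => (q i : ℂ)) * Vᴴ) (hp : ∀ i, 0 ≤ p i) (hq : ∀ i, 0 ≤ q i)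
    {t : ℝ} (ht : 0 < t) :
    IsGreatest (Set.range (quadVar P Q t))
      (∑ ij : n × n, Complex.normSq ((Uᴴ * V) ij.1 ij.2) *
        (p ij.1 ^ 2 / (q ij.2 + t * p ij.1))) := by
  have hs (i j) : 0 ≤ q j + t * p i := add_nonneg (hq j) (mul_nonneg ht.le (hp i))
  have hsp (i j) (h : q j + t * p i = 0) : p i = 0 := by
    have := hq j
    have := mul_nonneg ht.le (hp i)
    exact (mul_eq_zero.mp (by linarith : t * p i = 0)).resolve_left ht.ne'
  constructor
  · refine ⟨U * of (fun i j => ((p i / (q j + t * p i) : ℝ) : ℂ) * (Uᴴ * V) i j) * Vᴴ, ?_⟩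
    rw [quadVar_eq_sum hU hV hP hQ]
    exact sum_congr rfl fun ij _ => two_mul_re_sub_normSq_eq (hsp _ _) _
  · rintro _ ⟨W, rfl⟩
    have hW : W = U * (Uᴴ * W * V) * Vᴴ := by
      simp only [Matrix.mul_assoc, mul_eq_one_comm.mp hV, Matrix.mul_one]
      rw [← Matrix.mul_assoc, mul_eq_one_comm.mp hU, Matrix.one_mul]
    rw [hW, quadVar_eq_sum hU hV hP hQ]
    exact sum_le_sum fun ij _ => two_mul_re_sub_normSq_le (hs _ _) (hsp _ _) _ _

lemma sum_normSq_row {u : Matrix n n ℂ} (hu : u * uᴴ = 1) (i : n) :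
    ∑ j, Complex.normSq (u i j) = 1 := by
  have h := congrArg Complex.re (congrFun (congrFun hu i) i)
  simpa [Matrix.mul_apply, Complex.mul_conj] using h

lemma conjTranspose_mul_diagonal_mul_apply_self (u : Matrix n n ℂ) (p : n → ℝ) (j : n) :
    (uᴴ * diagonal (fun i => (p i : ℂ)) * u) j j = ((∑ i, Complex.normSq (u i j) * p i : ℝ) : ℂ) := by
  simp only [Matrix.mul_apply (M := uᴴ * _), mul_diagonal, conjTranspose_apply, Complex.ofReal_sum,
    Complex.ofReal_mul, Complex.normSq_eq_conj_mul_self]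
  exact sum_congr rfl fun i _ => by simp only [RCLike.star_def]; ring

end Spectral

section PartialTrace

variable {A B : Type*} [Fintype B]

lemma ptraceB_convexComb (M N : Matrix (A × B) (A × B) ℂ) (x y : ℝ) :
    ptraceB (x • M + y • N) = x • ptraceB M + y • ptraceB N := by
  ext a a'
  simp [ptraceB, sum_add_distrib, mul_sum]

lemma Matrix.PosSemidef.ptraceB {M : Matrix (A × B) (A × B) ℂ} (hM : M.PosSemidef) :
    (ptraceB M).PosSemidef := by
  have h : _root_.ptraceB M = ∑ b, M.submatrix (fun a => (a, b)) (fun a => (a, b)) := by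
    ext a a'
    simp [_root_.ptraceB, Matrix.sum_apply]
  rw [h]
  exact posSemidef_sum _ fun b _ => hM.submatrix _

variable [Fintype A] [DecidableEq B]

lemma ptraceB_kronecker_one_mul_mul (X Y : Matrix A A ℂ) (M : Matrix (A × B) (A × B) ℂ) :
    ptraceB ((X ⊗ₖ (1 : Matrix B B ℂ)) * M * (Y ⊗ₖ (1 : Matrix B B ℂ))) = X * ptraceB M * Y := by
  ext a a'
  simp only [ptraceB, of_apply, Matrix.mul_apply, Fintype.sum_prod_type, kroneckerMap_apply,
    one_apply, mul_ite, ite_mul, mul_one, mul_zero, zero_mul, sum_ite_eq, sum_ite_eq',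
    mem_univ, if_true, sum_mul, mul_sum]
  rw [sum_comm]
  refine sum_congr rfl fun c _ => ?_
  rw [sum_comm]

/-- Spectral data of the pair `(ρ, ρ_A ⊗ 1)`: `w` collects the squared overlaps of the
eigenvectors, `p` and `q` the eigenvalues. -/
lemma exists_spectral_data_s9 [DecidableEq A] {ρ : Matrix (A × B) (A × B) ℂ} (hρ : ρ.PosSemidef)
    (hρ1 : ρ.trace = 1) :
    ∃ w p q : (A × B) × (A × B) → ℝ, (∀ i, 0 ≤ p i) ∧ (∀ i, 0 ≤ q i) ∧
      (∀ i, q i = 0 → w i * p i = 0) ∧ ∑ i, w i * p i = 1 ∧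
      vNEnt (ptraceB ρ) - vNEnt ρ = ∑ i, w i * p i * (Real.log (p i) - Real.log (q i)) ∧
      ∀ t : ℝ, 0 < t → IsGreatest (Set.range (quadVar ρ (ptraceB ρ ⊗ₖ (1 : Matrix B B ℂ)) t))
        (∑ i, w i * (p i ^ 2 / (q i + t * p i))) := by
  have hA := hρ.ptraceB
  set U : Matrix (A × B) (A × B) ℂ := (hρ.1.eigenvectorUnitary).1
  set V₀ : Matrix A A ℂ := (hA.1.eigenvectorUnitary).1
  set V : Matrix (A × B) (A × B) ℂ := V₀ ⊗ₖ (1 : Matrix B B ℂ) with hVdef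
  set p := hρ.1.eigenvalues
  set q := hA.1.eigenvalues with hqdef
  have hU : Uᴴ * U = 1 := Unitary.coe_star_mul_self hρ.1.eigenvectorUnitary
  have hV₀ : V₀ᴴ * V₀ = 1 := Unitary.coe_star_mul_self hA.1.eigenvectorUnitary
  have hVh : Vᴴ = V₀ᴴ ⊗ₖ (1 : Matrix B B ℂ) := by
    rw [hVdef, conjTranspose_kronecker, conjTranspose_one]
  have hV : Vᴴ * V = 1 := by
    rw [hVh, hVdef, ← mul_kronecker_mul, hV₀, Matrix.one_mul, one_kronecker_one]
  have hP : ρ = U * diagonal (fun i => (p i : ℂ)) * Uᴴ :=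
    hρ.1.eq_eigenvectorUnitary_mul_diagonal_mul
  have hQ₀ : ptraceB ρ = V₀ * diagonal (fun i => (q i : ℂ)) * V₀ᴴ :=
    hA.1.eq_eigenvectorUnitary_mul_diagonal_mul
  have hQ : ptraceB ρ ⊗ₖ (1 : Matrix B B ℂ) =
      V * diagonal (fun j : A × B => (q j.1 : ℂ)) * Vᴴ := by
    have hd : diagonal (fun j : A × B => (q j.1 : ℂ)) =
        diagonal (fun i => (q i : ℂ)) ⊗ₖ (1 : Matrix B B ℂ) := by
      rw [← diagonal_one, diagonal_kronecker_diagonal]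
      simp
    rw [hd, hVh, hVdef, ← mul_kronecker_mul, ← mul_kronecker_mul, ← hQ₀, Matrix.one_mul,
      Matrix.one_mul]
  have hp : ∀ i, 0 ≤ p i := hρ.eigenvalues_nonneg
  have hq : ∀ i, 0 ≤ q i := hA.eigenvalues_nonneg
  set u := Uᴴ * V with hu
  have huu : u * uᴴ = 1 := by
    rw [hu, conjTranspose_mul, conjTranspose_conjTranspose, Matrix.mul_assoc,
      ← Matrix.mul_assoc V, mul_eq_one_comm.mp hV, Matrix.one_mul, hU]
  have hrow := sum_normSq_row huu
  have hmarg (k : A) : q k = ∑ b, ∑ i, Complex.normSq (u i (k, b)) * p i := by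
    have h : ptraceB (uᴴ * diagonal (fun i => (p i : ℂ)) * u) = diagonal (fun i => (q i : ℂ)) := by
      have h' : uᴴ * diagonal (fun i => (p i : ℂ)) * u = Vᴴ * ρ * V := by
        rw [hu, conjTranspose_mul, conjTranspose_conjTranspose, hP]
        simp only [Matrix.mul_assoc]
      rw [h', hVh, hVdef, ptraceB_kronecker_one_mul_mul, hQ₀]
      simp only [Matrix.mul_assoc, hV₀, Matrix.mul_one]
      rw [← Matrix.mul_assoc, hV₀, Matrix.one_mul]
    have h := congrFun (congrFun h k) k
    simp only [ptraceB, of_apply, conjTranspose_mul_diagonal_mul_apply_self,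
      diagonal_apply_eq] at h
    exact_mod_cast h.symm
  have hsum (f : A × B → ℝ) :
      ∑ ij : (A × B) × (A × B), Complex.normSq (u ij.1 ij.2) * f ij.1 = ∑ i, f i := by
    rw [Fintype.sum_prod_type]
    exact sum_congr rfl fun i _ => by simp only [← sum_mul, hrow, one_mul]
  refine ⟨fun ij => Complex.normSq (u ij.1 ij.2), fun ij => p ij.1, fun ij => q ij.2.1,
    fun ij => hp _, fun ij => hq _, ?_, ?_, ?_, fun t ht => ?_⟩
  · rintro ⟨i, k, b⟩ h
    have hnn (i b) : 0 ≤ Complex.normSq (u i (k, b)) * p i :=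
      mul_nonneg (Complex.normSq_nonneg _) (hp i)
    replace h : q k = 0 := h
    rw [hmarg k, sum_eq_zero_iff_of_nonneg fun b _ => sum_nonneg fun i _ => hnn i b] at h
    exact (sum_eq_zero_iff_of_nonneg fun i _ => hnn i b).mp (h b (mem_univ _)) i (mem_univ _)
  · rw [hsum]
    have h := hρ.1.trace_eq_sum_eigenvalues
    rw [hρ1] at h
    simpa using (congrArg Complex.re h).symm
  · rw [vNEnt_eq_sum_eigenvalues hA.1, vNEnt_eq_sum_eigenvalues hρ.1, ← hsum]
    simp only [mul_sub, sum_sub_distrib, mul_assoc]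
    have : ∑ k, q k * Real.log (q k) = ∑ ij : (A × B) × (A × B),
        Complex.normSq (u ij.1 ij.2) * (p ij.1 * Real.log (q ij.2.1)) := by
      rw [Fintype.sum_prod_type, sum_comm, Fintype.sum_prod_type]
      refine sum_congr rfl fun k _ => ?_
      nth_rw 1 [hmarg k]
      simp only [sum_mul, mul_assoc]
    rw [← hqdef, this]
    ring
  · exact isGreatest_quadVar hU hV hP hQ hp (fun j => hq j.1) ht

end PartialTrace

section Analysis

variable {ι : Type*} [Fintype ι] {w p q : ι → ℝ}

lemma hasDerivAt_sum_log (hp : ∀ i, 0 ≤ p i) (hq : ∀ i, 0 ≤ q i) {t : ℝ} (ht : 0 < t) :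
    HasDerivAt (fun t => ∑ i, w i * p i * (Real.log (q i + t * p i) - Real.log (q i)))
      (∑ i, w i * (p i ^ 2 / (q i + t * p i))) t := by
  refine HasDerivAt.fun_sum fun i _ => ?_
  rcases (hp i).eq_or_lt with h | h
  · simpa [← h] using hasDerivAt_const t (0 : ℝ)
  · have hne : q i + t * p i ≠ 0 := (add_pos_of_nonneg_of_pos (hq i) (mul_pos ht h)).ne'
    have hd := ((((hasDerivAt_id' t).mul_const (p i)).const_add (q i)).log hne).sub_const
      (Real.log (q i))
    exact (hd.const_mul (w i * p i)).congr_deriv (by ring)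

lemma continuousOn_sum_log (hp : ∀ i, 0 ≤ p i) (hq : ∀ i, 0 ≤ q i)
    (hw : ∀ i, q i = 0 → w i * p i = 0) :
    ContinuousOn (fun t => ∑ i, w i * p i * (Real.log (q i + t * p i) - Real.log (q i)))
      (Set.Ici 0) := by
  refine continuousOn_finsetSum _ fun i _ => ?_
  rcases (hq i).eq_or_lt with h | h
  · simpa [hw i h.symm] using continuousOn_const
  · refine continuousOn_const.mul ((ContinuousOn.log (by fun_prop) fun t ht => ?_).sub
      continuousOn_const)
    exact (add_pos_of_pos_of_nonneg h (mul_nonneg ht (hp i))).ne'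

lemma tendsto_sum_log (hp : ∀ i, 0 ≤ p i) (hq : ∀ i, 0 ≤ q i) (h1 : ∑ i, w i * p i = 1) :
    Tendsto (fun t => ∑ i, w i * p i * (Real.log (q i + t * p i) - Real.log (q i)) - Real.log t)
      atTop (𝓝 (∑ i, w i * p i * (Real.log (p i) - Real.log (q i)))) := by
  have h : Tendsto (fun t : ℝ => ∑ i, w i * p i * (Real.log (q i / t + p i) - Real.log (q i)))
      atTop (𝓝 (∑ i, w i * p i * (Real.log (p i) - Real.log (q i)))) := by
    refine tendsto_finsetSum _ fun i _ => ?_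
    rcases (hp i).eq_or_lt with h | h
    · simp [← h]
    · have hlim : Tendsto (fun t : ℝ => q i / t + p i) atTop (𝓝 (p i)) := by
        simpa using (tendsto_const_nhds.div_atTop tendsto_id).add_const (p i)
      exact ((hlim.log h.ne').sub_const _).const_mul _
  refine h.congr' ?_
  filter_upwards [eventually_gt_atTop 0] with t ht
  rw [← one_mul (Real.log t), ← h1, sum_mul, ← sum_sub_distrib]
  refine sum_congr rfl fun i _ => ?_
  rcases (hp i).eq_or_lt with h | h
  · simp [← h]
  · have hpos : 0 < q i + t * p i := add_pos_of_nonneg_of_pos (hq i) (mul_pos ht h)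
    have : q i / t + p i = (q i + t * p i) / t := by field_simp
    rw [this, Real.log_div hpos.ne' ht.ne']
    ring

end Analysis

/-- Concavity of the conditional entropy `ρ_{AB} ↦ S(ρ_{AB}) - S(ρ_A)`. -/
theorem condEnt_concave {dA dB : ℕ}
    (ρ σ : Matrix (Fin dA × Fin dB) (Fin dA × Fin dB) ℂ)
    (hρ : ρ.PosSemidef) (hρ1 : ρ.trace = 1)
    (hσ : σ.PosSemidef) (hσ1 : σ.trace = 1)
    (x : ℝ) (hx0 : 0 ≤ x) (hx1 : x ≤ 1) :
    x * (vNEnt ρ - vNEnt (ptraceB ρ)) + (1 - x) * (vNEnt σ - vNEnt (ptraceB σ)) ≤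
      vNEnt (x • ρ + (1 - x) • σ) - vNEnt (ptraceB (x • ρ + (1 - x) • σ)) := by
  have hy0 : 0 ≤ 1 - x := sub_nonneg.mpr hx1
  have hτ : (x • ρ + (1 - x) • σ).PosSemidef := (hρ.smul hx0).add (hσ.smul hy0)
  have hτ1 : (x • ρ + (1 - x) • σ).trace = 1 := by
    rw [trace_add, trace_smul, trace_smul, hρ1, hσ1, ← add_smul, add_sub_cancel, one_smul]
  obtain ⟨w₁, p₁, q₁, hp₁, hq₁, hw₁, hs₁, he₁, hg₁⟩ := exists_spectral_data_s9 hρ hρ1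
  obtain ⟨w₂, p₂, q₂, hp₂, hq₂, hw₂, hs₂, he₂, hg₂⟩ := exists_spectral_data_s9 hσ hσ1
  obtain ⟨w₃, p₃, q₃, hp₃, hq₃, hw₃, hs₃, he₃, hg₃⟩ := exists_spectral_data_s9 hτ hτ1
  set φ₁ := fun t : ℝ => ∑ i, w₁ i * p₁ i * (Real.log (q₁ i + t * p₁ i) - Real.log (q₁ i)) with hφ₁
  set φ₂ := fun t : ℝ => ∑ i, w₂ i * p₂ i * (Real.log (q₂ i + t * p₂ i) - Real.log (q₂ i)) with hφ₂
  set φ₃ := fun t : ℝ => ∑ i, w₃ i * p₃ i * (Real.log (q₃ i + t * p₃ i) - Real.log (q₃ i)) with hφ₃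
  have hderiv (t : ℝ) (ht : 0 < t) := (((hasDerivAt_sum_log (w := w₁) hp₁ hq₁ ht).const_mul x).add
    ((hasDerivAt_sum_log (w := w₂) hp₂ hq₂ ht).const_mul (1 - x))).sub
    (hasDerivAt_sum_log (w := w₃) hp₃ hq₃ ht)
  have hmono : MonotoneOn (fun t => x * φ₁ t + (1 - x) * φ₂ t - φ₃ t) (Set.Ici 0) := by
    refine monotoneOn_of_deriv_nonneg (convex_Ici 0) ?_ ?_ ?_
    · exact ((continuousOn_const.mul (continuousOn_sum_log hp₁ hq₁ hw₁)).add
        (continuousOn_const.mul (continuousOn_sum_log hp₂ hq₂ hw₂))).sub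
        (continuousOn_sum_log hp₃ hq₃ hw₃)
    · intro t ht
      rw [interior_Ici] at ht
      exact (hderiv t ht).differentiableAt.differentiableWithinAt
    · intro t ht
      rw [interior_Ici] at ht
      refine le_of_le_of_eq ?_ (hderiv t ht).deriv.symm
      obtain ⟨W, hW⟩ := (hg₃ t ht).1
      rw [ptraceB_convexComb, add_kronecker, smul_kronecker, smul_kronecker,
        quadVar_convexComb] at hW
      rw [← hW, sub_nonneg]
      exact add_le_add (mul_le_mul_of_nonneg_left ((hg₁ t ht).2 ⟨W, rfl⟩) hx0)
        (mul_le_mul_of_nonneg_left ((hg₂ t ht).2 ⟨W, rfl⟩) hy0)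
  have hlim := (((tendsto_sum_log hp₁ hq₁ hs₁).const_mul x).add
    ((tendsto_sum_log hp₂ hq₂ hs₂).const_mul (1 - x))).sub (tendsto_sum_log hp₃ hq₃ hs₃)
  rw [← he₁, ← he₂, ← he₃] at hlim
  have hnonneg := ge_of_tendsto hlim (b := 0) <| by
    filter_upwards [eventually_ge_atTop 0] with t ht
    have h := hmono Set.self_mem_Ici ht ht
    simp only [hφ₁, hφ₂, hφ₃, zero_mul, add_zero, sub_self, mul_zero, sum_const_zero] at h
    linarith
  linarith
end

section
/- Let Φ(X) = Σ_j K_j X K_j†, where the K_j are d'×d complex matrices with Σ_j K_j† K_j = I_d (a completely positive trace-preserving map). Then ρ ↦ S(ρ) − S(Φ(ρ)) is concave on density matrices: for density matrices ρ, σ and x ∈ [0,1], S(xρ+(1−x)σ) − S(Φ(xρ+(1−x)σ)) ≥ x[S(ρ) − S(Φ(ρ))] + (1−x)[S(σ) − S(Φ(σ))]. -/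
open Matrix MeasureTheory
open scoped Kronecker ComplexOrder

section SpectralOverlap

variable {n : Type*} [Fintype n] [DecidableEq n]

/-- The squared moduli `|⟨vⱼ, uᵢ⟩|²` of the inner products of the eigenvectors `uᵢ` of `A` with
the eigenvectors `vⱼ` of `B`. -/
noncomputable def spectralOverlap {A B : Matrix n n ℂ} (hA : A.IsHermitian) (hB : B.IsHermitian)
    (j i : n) : ℝ :=
  Complex.normSq ((star (hB.eigenvectorUnitary : Matrix n n ℂ) * hA.eigenvectorUnitary) j i)

theorem spectralOverlap_nonneg {A B : Matrix n n ℂ} (hA : A.IsHermitian) (hB : B.IsHermitian)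
    (j i : n) : 0 ≤ spectralOverlap hA hB j i :=
  Complex.normSq_nonneg _

theorem sum_spectralOverlap {A B : Matrix n n ℂ} (hA : A.IsHermitian) (hB : B.IsHermitian)
    (i : n) : ∑ j, spectralOverlap hA hB j i = 1 := by
  set C : Matrix n n ℂ := star (hB.eigenvectorUnitary : Matrix n n ℂ) * hA.eigenvectorUnitary
    with hC
  have hCC : star C * C = 1 := by
    have h1 : (hB.eigenvectorUnitary : Matrix n n ℂ) * star (hB.eigenvectorUnitary : Matrix n n ℂ)
      = 1 := Unitary.coe_mul_star_self _
    have h2 : star (hA.eigenvectorUnitary : Matrix n n ℂ) * (hA.eigenvectorUnitary : Matrix n n ℂ)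
      = 1 := Unitary.coe_star_mul_self _
    rw [hC, star_mul, star_star, Matrix.mul_assoc, ← Matrix.mul_assoc _ (star _), h1,
      Matrix.one_mul, h2]
  have h := congrFun (congrFun hCC i) i
  rw [Matrix.mul_apply, Matrix.one_apply_eq] at h
  have h' := congrArg Complex.re h
  simp only [Matrix.star_apply, Complex.re_sum, Complex.one_re] at h'
  rw [← h']
  refine Finset.sum_congr rfl fun j _ => ?_
  simp [spectralOverlap, ← hC, Complex.normSq_apply]

theorem isHermitian_eq_mul_diagonal_mul_star {A : Matrix n n ℂ} (hA : A.IsHermitian) :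
    A = (hA.eigenvectorUnitary : Matrix n n ℂ) * diagonal (fun i => (hA.eigenvalues i : ℂ)) *
      star (hA.eigenvectorUnitary : Matrix n n ℂ) := by
  conv_lhs => rw [hA.spectral_theorem]
  rfl

/-- `Re Tr[U diag(p) U* V diag(f) V*] = ∑ⱼᵢ |(V*U)ⱼᵢ|² pᵢ fⱼ`. -/
theorem re_trace_conj_diagonal_mul (U V : Matrix n n ℂ) (p f : n → ℝ) :
    ((U * diagonal (fun i => (p i : ℂ)) * star U *
      (V * diagonal (fun i => (f i : ℂ)) * star V)).trace).re =
    ∑ j, ∑ i, Complex.normSq ((star V * U) j i) * p i * f j := by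
  have h : (U * diagonal (fun i => (p i : ℂ)) * star U *
      (V * diagonal (fun i => (f i : ℂ)) * star V)).trace =
      ((star V * U) * diagonal (fun i => (p i : ℂ)) * star (star V * U) *
        diagonal (fun i => (f i : ℂ))).trace := by
    rw [← Matrix.mul_assoc, Matrix.trace_mul_comm, star_mul, star_star]
    simp only [Matrix.mul_assoc]
  rw [h, Matrix.trace, Complex.re_sum]
  refine Finset.sum_congr rfl fun j _ => ?_
  rw [Matrix.diag_apply, Matrix.mul_diagonal, Matrix.mul_apply, Finset.sum_mul, Complex.re_sum]
  refine Finset.sum_congr rfl fun i _ => ?_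
  rw [Matrix.mul_diagonal, Matrix.star_apply]
  simp only [Complex.normSq_apply, RCLike.star_def, Complex.mul_re, Complex.mul_im,
    Complex.conj_re, Complex.conj_im, Complex.ofReal_re, Complex.ofReal_im]
  ring

theorem re_trace_mul_matLog {A B : Matrix n n ℂ} (hA : A.IsHermitian) (hB : B.IsHermitian) :
    ((A * matLog B).trace).re =
      ∑ j, ∑ i, spectralOverlap hA hB j i * hA.eigenvalues i * Real.log (hB.eigenvalues j) := by
  have hlog : matLog B = (hB.eigenvectorUnitary : Matrix n n ℂ) *
      diagonal (fun i => (Real.log (hB.eigenvalues i) : ℂ)) *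
      star (hB.eigenvectorUnitary : Matrix n n ℂ) := by
    rw [matLog, dif_pos hB]; rfl
  rw [hlog]
  conv_lhs => rw [isHermitian_eq_mul_diagonal_mul_star hA]
  exact re_trace_conj_diagonal_mul _ _ _ _

theorem sum_spectralOverlap_mul {A B : Matrix n n ℂ} (hA : A.IsHermitian) (hB : B.IsHermitian)
    (f : n → ℝ) : ∑ j, ∑ i, spectralOverlap hA hB j i * f i = ∑ i, f i := by
  rw [Finset.sum_comm]
  refine Finset.sum_congr rfl fun i _ => ?_
  rw [← Finset.sum_mul, sum_spectralOverlap, one_mul]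

theorem re_trace_mul_matLog_self {A B : Matrix n n ℂ} (hA : A.IsHermitian) (hB : B.IsHermitian) :
    ((A * matLog A).trace).re =
      ∑ j, ∑ i, spectralOverlap hA hB j i *
        (hA.eigenvalues i * Real.log (hA.eigenvalues i)) := by
  have hC : star (hA.eigenvectorUnitary : Matrix n n ℂ) * hA.eigenvectorUnitary = 1 :=
    Unitary.coe_star_mul_self _
  rw [sum_spectralOverlap_mul, re_trace_mul_matLog hA hA]
  refine Finset.sum_congr rfl fun j _ => ?_
  rw [Finset.sum_eq_single j]
  · simp [spectralOverlap, hC]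
  · intro i _ hij
    simp [spectralOverlap, hC, Matrix.one_apply_ne hij.symm]
  · simp

theorem re_trace_eq_sum_spectralOverlap {A B : Matrix n n ℂ} (hA : A.IsHermitian)
    (hB : B.IsHermitian) :
    A.trace.re = ∑ j, ∑ i, spectralOverlap hA hB j i * hA.eigenvalues i := by
  rw [sum_spectralOverlap_mul, hA.trace_eq_sum_eigenvalues]
  simp

/-- If `c A ≤ B` with `c > 0`, then `A` vanishes on the kernel of `B`. -/
theorem spectralOverlap_mul_eigenvalues_eq_zero {A B : Matrix n n ℂ} (hA : A.PosSemidef)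
    (hB : B.PosSemidef) {c : ℝ} (hc : 0 < c) (hAB : (B - c • A).PosSemidef) {j : n}
    (hj : hB.isHermitian.eigenvalues j = 0) (i : n) :
    spectralOverlap hA.isHermitian hB.isHermitian j i * hA.isHermitian.eigenvalues i = 0 := by
  set V : Matrix n n ℂ := (hB.isHermitian.eigenvectorUnitary : Matrix n n ℂ) with hV
  set U : Matrix n n ℂ := (hA.isHermitian.eigenvectorUnitary : Matrix n n ℂ) with hU
  have hVV : star V * V = 1 := Unitary.coe_star_mul_self _
  have hdiagA : ((star V * A * V) j j).re =
      ∑ i, spectralOverlap hA.isHermitian hB.isHermitian j i *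
        hA.isHermitian.eigenvalues i := by
    have h : star V * A * V = (star V * U) *
        diagonal (fun i => (hA.isHermitian.eigenvalues i : ℂ)) * star (star V * U) := by
      conv_lhs => rw [isHermitian_eq_mul_diagonal_mul_star hA.isHermitian]
      rw [star_mul, star_star]
      simp only [Matrix.mul_assoc, hU]
    rw [h, Matrix.mul_apply, Complex.re_sum]
    refine Finset.sum_congr rfl fun i _ => ?_
    rw [Matrix.mul_diagonal, Matrix.star_apply]
    simp [spectralOverlap, ← hV, ← hU, Complex.normSq_apply]
    ring
  have hdiagB : (star V * B * V) j j = 0 := by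
    have h : star V * B * V = diagonal (fun i => (hB.isHermitian.eigenvalues i : ℂ)) := by
      conv_lhs => rw [isHermitian_eq_mul_diagonal_mul_star hB.isHermitian]
      rw [← hV]
      simp only [Matrix.mul_assoc, hVV, Matrix.mul_one]
      rw [← Matrix.mul_assoc, hVV, Matrix.one_mul]
    rw [h, Matrix.diagonal_apply_eq, hj, Complex.ofReal_zero]
  have hnn : 0 ≤ ((star V * (B - c • A) * V) j j).re := by
    have h := (hAB.conjTranspose_mul_mul_same V).diag_nonneg (i := j)
    exact (Complex.le_def.1 h).1
  have hle : (∑ i, spectralOverlap hA.isHermitian hB.isHermitian j i *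
      hA.isHermitian.eigenvalues i) ≤ 0 := by
    rw [Matrix.mul_sub, Matrix.sub_mul, Matrix.sub_apply, hdiagB, Matrix.mul_smul,
      Matrix.smul_mul, Matrix.smul_apply, zero_sub, Complex.neg_re, Complex.smul_re, hdiagA,
      smul_eq_mul] at hnn
    nlinarith
  have hterm : ∀ i ∈ Finset.univ, 0 ≤ spectralOverlap hA.isHermitian hB.isHermitian j i *
      hA.isHermitian.eigenvalues i := fun i _ =>
    mul_nonneg (spectralOverlap_nonneg _ _ _ _) (hA.eigenvalues_nonneg i)
  exact (Finset.sum_eq_zero_iff_of_nonneg hterm).1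
    (le_antisymm hle (Finset.sum_nonneg hterm)) i (Finset.mem_univ i)

end SpectralOverlap

section ResolventForm

variable {n : Type*} [Fintype n] [DecidableEq n]

/-- The resolvent form `⟨A, (L_B + s R_A)⁻¹ A⟩`, where `L_B` and `R_A` are the left and right
multiplications, in the eigenbases of `A` and `B`. -/
noncomputable def resolventForm {A B : Matrix n n ℂ} (hA : A.IsHermitian) (hB : B.IsHermitian)
    (s : ℝ) : ℝ :=
  ∑ j, ∑ i, spectralOverlap hA hB j i * hA.eigenvalues i *
    (hA.eigenvalues i / (hB.eigenvalues j + s * hA.eigenvalues i))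

/-- The functional whose supremum over `X` is the resolvent form. -/
noncomputable def resolventFunctional (A B : Matrix n n ℂ) (s : ℝ) (X : Matrix n n ℂ) : ℝ :=
  2 * ((star X * A).trace).re - ((B * (X * star X)).trace).re - s * ((A * (star X * X)).trace).re

theorem resolventFunctional_eq_sum {A B : Matrix n n ℂ} (hA : A.IsHermitian)
    (hB : B.IsHermitian) (s : ℝ) (Z : Matrix n n ℂ) :
    resolventFunctional A B s ((hB.eigenvectorUnitary : Matrix n n ℂ) * Z *
      star (hA.eigenvectorUnitary : Matrix n n ℂ)) =
    ∑ j, ∑ i, (2 * (star (Z j i) * (star (hB.eigenvectorUnitary : Matrix n n ℂ) *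
        hA.eigenvectorUnitary) j i).re * hA.eigenvalues i -
      (hB.eigenvalues j + s * hA.eigenvalues i) * Complex.normSq (Z j i)) := by
  set V : Matrix n n ℂ := (hB.eigenvectorUnitary : Matrix n n ℂ) with hV
  set U : Matrix n n ℂ := (hA.eigenvectorUnitary : Matrix n n ℂ) with hU
  have hVV : star V * V = 1 := Unitary.coe_star_mul_self _
  have hUU : star U * U = 1 := Unitary.coe_star_mul_self _
  have hUA := isHermitian_eq_mul_diagonal_mul_star hA
  have hVB := isHermitian_eq_mul_diagonal_mul_star hB
  rw [← hU] at hUA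
  rw [← hV] at hVB
  set P : Matrix n n ℂ := diagonal (fun i => (hA.eigenvalues i : ℂ)) with hP
  set Q : Matrix n n ℂ := diagonal (fun i => (hB.eigenvalues i : ℂ)) with hQ
  have h1 : (star (V * Z * star U) * A).trace = (star Z * ((star V * U) * P)).trace := by
    have : star (V * Z * star U) * A = U * (star Z * ((star V * U) * P) * star U) := by
      rw [hUA]
      simp only [star_mul, star_star, Matrix.mul_assoc]
    rw [this, Matrix.trace_mul_comm, Matrix.mul_assoc, hUU, Matrix.mul_one]
  have h2 : (B * ((V * Z * star U) * star (V * Z * star U))).trace =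
      (Q * (Z * star Z)).trace := by
    have : B * ((V * Z * star U) * star (V * Z * star U)) =
        V * (Q * ((star V * V) * Z * (star U * U) * star Z) * star V) := by
      rw [hVB]
      simp only [star_mul, star_star, Matrix.mul_assoc]
    rw [this, Matrix.trace_mul_comm, Matrix.mul_assoc, hVV, hUU, Matrix.mul_one, Matrix.mul_one,
      Matrix.one_mul]
  have h3 : (A * (star (V * Z * star U) * (V * Z * star U))).trace =
      (P * (star Z * Z)).trace := by
    have : A * (star (V * Z * star U) * (V * Z * star U)) =
        U * (P * ((star U * U) * star Z * (star V * V) * Z) * star U) := by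
      rw [hUA]
      simp only [star_mul, star_star, Matrix.mul_assoc]
    rw [this, Matrix.trace_mul_comm, Matrix.mul_assoc, hVV, hUU, Matrix.mul_one, Matrix.mul_one,
      Matrix.one_mul]
  have e1 : ((star Z * ((star V * U) * P)).trace).re =
      ∑ j, ∑ i, (star (Z j i) * (star V * U) j i).re * hA.eigenvalues i := by
    rw [Matrix.trace, Complex.re_sum, Finset.sum_comm]
    refine Finset.sum_congr rfl fun i _ => ?_
    rw [Matrix.diag_apply, Matrix.mul_apply, Complex.re_sum]
    refine Finset.sum_congr rfl fun j _ => ?_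
    rw [hP, Matrix.mul_diagonal, Matrix.star_apply, ← mul_assoc, Complex.re_mul_ofReal]
  have e2 : ((Q * (Z * star Z)).trace).re =
      ∑ j, ∑ i, hB.eigenvalues j * Complex.normSq (Z j i) := by
    rw [Matrix.trace, Complex.re_sum]
    refine Finset.sum_congr rfl fun j _ => ?_
    rw [Matrix.diag_apply, hQ, Matrix.diagonal_mul, Complex.re_ofReal_mul, Matrix.mul_apply,
      Complex.re_sum, Finset.mul_sum]
    refine Finset.sum_congr rfl fun i _ => ?_
    simp [Complex.normSq_apply]
  have e3 : ((P * (star Z * Z)).trace).re =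
      ∑ j, ∑ i, hA.eigenvalues i * Complex.normSq (Z j i) := by
    rw [Matrix.trace, Complex.re_sum, Finset.sum_comm]
    refine Finset.sum_congr rfl fun i _ => ?_
    rw [Matrix.diag_apply, hP, Matrix.diagonal_mul, Complex.re_ofReal_mul, Matrix.mul_apply,
      Complex.re_sum, Finset.mul_sum]
    refine Finset.sum_congr rfl fun j _ => ?_
    simp [Complex.normSq_apply]
  rw [resolventFunctional, h1, h2, h3, e1, e2, e3]
  simp only [Finset.mul_sum, ← Finset.sum_sub_distrib]
  refine Finset.sum_congr rfl fun j _ => Finset.sum_congr rfl fun i _ => ?_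
  ring

theorem resolventFunctional_le_resolventForm {A B : Matrix n n ℂ} (hA : A.PosSemidef)
    (hB : B.PosSemidef) {s : ℝ} (hs : 0 < s) (X : Matrix n n ℂ) :
    resolventFunctional A B s X ≤ resolventForm hA.isHermitian hB.isHermitian s := by
  set V : Matrix n n ℂ := (hB.isHermitian.eigenvectorUnitary : Matrix n n ℂ) with hV
  set U : Matrix n n ℂ := (hA.isHermitian.eigenvectorUnitary : Matrix n n ℂ) with hU
  have hVV : V * star V = 1 := Unitary.coe_mul_star_self _
  have hUU : U * star U = 1 := Unitary.coe_mul_star_self _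
  have hX : X = V * (star V * X * U) * star U := by
    rw [← Matrix.mul_assoc, ← Matrix.mul_assoc, hVV, Matrix.one_mul, Matrix.mul_assoc, hUU,
      Matrix.mul_one]
  rw [hX, resolventFunctional_eq_sum hA.isHermitian hB.isHermitian]
  refine Finset.sum_le_sum fun j _ => Finset.sum_le_sum fun i _ => ?_
  rw [spectralOverlap]
  set z := (star V * X * U) j i
  set c := (star (hB.isHermitian.eigenvectorUnitary : Matrix n n ℂ) *
    hA.isHermitian.eigenvectorUnitary) j i
  have hp := hA.eigenvalues_nonneg i
  have hq := hB.eigenvalues_nonneg j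
  set p := hA.isHermitian.eigenvalues i
  set q := hB.isHermitian.eigenvalues j
  rcases hp.eq_or_lt with h0 | hp
  · rw [← h0]
    have := mul_nonneg hq (Complex.normSq_nonneg z)
    simpa using this
  · have hr : 0 < q + s * p := by positivity
    rw [mul_div_assoc', le_div_iff₀ hr]
    simp only [Complex.normSq_apply, RCLike.star_def, Complex.mul_re, Complex.conj_re,
      Complex.conj_im]
    set r := q + s * p
    nlinarith [sq_nonneg (r * z.re - p * c.re), sq_nonneg (r * z.im - p * c.im)]

theorem exists_resolventFunctional_eq_resolventForm {A B : Matrix n n ℂ} (hA : A.PosSemidef)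
    (hB : B.PosSemidef) {s : ℝ} (hs : 0 < s) :
    ∃ X, resolventFunctional A B s X = resolventForm hA.isHermitian hB.isHermitian s := by
  refine ⟨_, (resolventFunctional_eq_sum hA.isHermitian hB.isHermitian s
    (Matrix.of fun j i => (star (hB.isHermitian.eigenvectorUnitary : Matrix n n ℂ) *
    hA.isHermitian.eigenvectorUnitary) j i * ((hA.isHermitian.eigenvalues i /
      (hB.isHermitian.eigenvalues j + s * hA.isHermitian.eigenvalues i) : ℝ) : ℂ))).trans ?_⟩
  refine Finset.sum_congr rfl fun j _ => Finset.sum_congr rfl fun i _ => ?_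
  rw [spectralOverlap, Matrix.of_apply]
  set c := (star (hB.isHermitian.eigenvectorUnitary : Matrix n n ℂ) *
    hA.isHermitian.eigenvectorUnitary) j i
  have hp := hA.eigenvalues_nonneg i
  have hq := hB.eigenvalues_nonneg j
  set p := hA.isHermitian.eigenvalues i
  set q := hB.isHermitian.eigenvalues j
  rcases hp.eq_or_lt with h0 | hp
  · simp [← h0]
  · have hr : q + s * p ≠ 0 := by positivity
    rw [map_mul, Complex.normSq_ofReal, star_mul']
    simp only [Complex.normSq_apply, RCLike.star_def, Complex.mul_re, Complex.mul_im,
      Complex.conj_re, Complex.conj_im, Complex.ofReal_re, Complex.ofReal_im]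
    field_simp
    ring

end ResolventForm

section Kraus

variable {n n' m : Type*} [Fintype n] [Fintype n'] [Fintype m]

theorem posSemidef_sum_kraus (K : m → Matrix n' n ℂ) {A : Matrix n n ℂ} (hA : A.PosSemidef) :
    (∑ j, K j * A * (K j)ᴴ).PosSemidef :=
  Matrix.posSemidef_sum _ fun j _ => hA.mul_mul_conjTranspose_same (K j)

theorem trace_sum_kraus_mul (K : m → Matrix n' n ℂ) (A : Matrix n n ℂ) (Y : Matrix n' n' ℂ) :
    ((∑ j, K j * A * (K j)ᴴ) * Y).trace = (A * ∑ j, (K j)ᴴ * Y * K j).trace := by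
  rw [Finset.sum_mul, Finset.mul_sum, Matrix.trace_sum, Matrix.trace_sum]
  refine Finset.sum_congr rfl fun j _ => ?_
  rw [Matrix.mul_assoc, Matrix.mul_assoc, Matrix.trace_mul_comm]
  simp only [Matrix.mul_assoc]

theorem trace_sum_kraus [DecidableEq n] {K : m → Matrix n' n ℂ} (hK : ∑ j, (K j)ᴴ * K j = 1)
    (A : Matrix n n ℂ) : (∑ j, K j * A * (K j)ᴴ).trace = A.trace := by
  classical
  have h := trace_sum_kraus_mul K A 1
  simpa [hK] using h

/-- The Schwarz inequality for the adjoint of a Kraus map, tested against `A`. -/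
theorem re_trace_mul_adjoint_kraus_le [DecidableEq n] {K : m → Matrix n' n ℂ}
    (hK : ∑ j, (K j)ᴴ * K j = 1)
    {A : Matrix n n ℂ} (hA : A.PosSemidef) (Y : Matrix n' n' ℂ) :
    ((A * ((∑ j, (K j)ᴴ * Y * K j) * (∑ j, (K j)ᴴ * Y * K j)ᴴ)).trace).re ≤
      (((∑ j, K j * A * (K j)ᴴ) * (Y * Yᴴ)).trace).re := by
  set X := ∑ j, (K j)ᴴ * Y * K j with hX
  have hXs : Xᴴ = ∑ j, (K j)ᴴ * Yᴴ * K j := by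
    simp [hX, Matrix.conjTranspose_sum, Matrix.mul_assoc]
  have key : ∑ j, (K j)ᴴ * (Y * Yᴴ) * K j - X * Xᴴ =
      ∑ j, ((K j)ᴴ * Y - X * (K j)ᴴ) * ((K j)ᴴ * Y - X * (K j)ᴴ)ᴴ := by
    have e : ∀ j, ((K j)ᴴ * Y - X * (K j)ᴴ) * ((K j)ᴴ * Y - X * (K j)ᴴ)ᴴ =
        (K j)ᴴ * (Y * Yᴴ) * K j - ((K j)ᴴ * Y * K j) * Xᴴ - X * ((K j)ᴴ * Yᴴ * K j)
          + X * ((K j)ᴴ * K j) * Xᴴ := by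
      intro j
      simp only [Matrix.conjTranspose_sub, Matrix.conjTranspose_mul,
        Matrix.conjTranspose_conjTranspose, Matrix.sub_mul, Matrix.mul_sub, Matrix.mul_assoc]
      abel
    simp only [e, Finset.sum_add_distrib, Finset.sum_sub_distrib, ← Finset.sum_mul,
      ← Finset.mul_sum, hK, ← hX, ← hXs, Matrix.mul_one]
    abel
  rw [trace_sum_kraus_mul, ← sub_nonneg, ← Complex.sub_re, ← Matrix.trace_sub, ← Matrix.mul_sub,
    key, Finset.mul_sum, Matrix.trace_sum, Complex.re_sum]
  refine Finset.sum_nonneg fun j _ => ?_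
  rw [← Matrix.mul_assoc, Matrix.trace_mul_comm, ← Matrix.mul_assoc]
  have h := (hA.conjTranspose_mul_mul_same ((K j)ᴴ * Y - X * (K j)ᴴ)).trace_nonneg
  exact (Complex.le_def.1 h).1

theorem resolventForm_kraus_le [DecidableEq n] [DecidableEq n'] {K : m → Matrix n' n ℂ}
    (hK : ∑ j, (K j)ᴴ * K j = 1)
    {A B : Matrix n n ℂ} (hA : A.PosSemidef) (hB : B.PosSemidef) {s : ℝ} (hs : 0 < s) :
    resolventForm (posSemidef_sum_kraus K hA).isHermitian (posSemidef_sum_kraus K hB).isHermitian s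
      ≤ resolventForm hA.isHermitian hB.isHermitian s := by
  obtain ⟨Y, hY⟩ := exists_resolventFunctional_eq_resolventForm (posSemidef_sum_kraus K hA)
    (posSemidef_sum_kraus K hB) hs
  rw [← hY]
  refine le_trans ?_ (resolventFunctional_le_resolventForm hA hB hs (∑ j, (K j)ᴴ * Y * K j))
  have hXs : (∑ j, (K j)ᴴ * Y * K j)ᴴ = ∑ j, (K j)ᴴ * Yᴴ * K j := by
    simp [Matrix.conjTranspose_sum, Matrix.mul_assoc]
  have h1 : ((star Y * ∑ j, K j * A * (K j)ᴴ)).trace =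
      (star (∑ j, (K j)ᴴ * Y * K j) * A).trace := by
    rw [Matrix.trace_mul_comm, trace_sum_kraus_mul, Matrix.trace_mul_comm,
      Matrix.star_eq_conjTranspose, Matrix.star_eq_conjTranspose, hXs]
  have h2 := re_trace_mul_adjoint_kraus_le hK hB Y
  have h3 := re_trace_mul_adjoint_kraus_le hK hA Yᴴ
  rw [← hXs, Matrix.conjTranspose_conjTranspose, Matrix.conjTranspose_conjTranspose] at h3
  rw [resolventFunctional, resolventFunctional, h1]
  simp only [Matrix.star_eq_conjTranspose]
  have := mul_le_mul_of_nonneg_left h3 hs.le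
  linarith

end Kraus

section LogForm

open Filter Topology

variable {n : Type*} [Fintype n] [DecidableEq n]

/-- `⟨A^{1/2}, log(L_B + s R_A) A^{1/2}⟩` in the eigenbases of `A` and `B`. -/
noncomputable def logForm {A B : Matrix n n ℂ} (hA : A.IsHermitian) (hB : B.IsHermitian)
    (s : ℝ) : ℝ :=
  ∑ j, ∑ i, spectralOverlap hA hB j i * hA.eigenvalues i *
    Real.log (hB.eigenvalues j + s * hA.eigenvalues i)

theorem hasDerivAt_logForm {A B : Matrix n n ℂ} (hA : A.PosSemidef) (hB : B.PosSemidef) {s : ℝ}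
    (hs : 0 < s) :
    HasDerivAt (logForm hA.isHermitian hB.isHermitian)
      (resolventForm hA.isHermitian hB.isHermitian s) s := by
  unfold logForm resolventForm
  refine HasDerivAt.fun_sum fun j _ => HasDerivAt.fun_sum fun i _ => ?_
  have hp := hA.eigenvalues_nonneg i
  have hq := hB.eigenvalues_nonneg j
  set p := hA.isHermitian.eigenvalues i
  set q := hB.isHermitian.eigenvalues j
  rcases hp.eq_or_lt with h0 | hp
  · simpa [← h0] using hasDerivAt_const s (0 : ℝ)
  · have hr : q + s * p ≠ 0 := by positivity
    have h : HasDerivAt (fun s => q + s * p) p s := by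
      simpa using ((hasDerivAt_id s).mul_const p).const_add q
    exact (h.log hr).const_mul _

theorem tendsto_logForm_zero {A B : Matrix n n ℂ} (hA : A.PosSemidef) (hB : B.PosSemidef) {c : ℝ}
    (hc : 0 < c) (hAB : (B - c • A).PosSemidef) :
    Tendsto (logForm hA.isHermitian hB.isHermitian) (𝓝[>] 0) (𝓝 ((A * matLog B).trace).re) := by
  rw [re_trace_mul_matLog hA.isHermitian hB.isHermitian]
  unfold logForm
  refine Tendsto.mono_left ?_ nhdsWithin_le_nhds
  refine tendsto_finsetSum _ fun j _ => tendsto_finsetSum _ fun i _ => ?_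
  by_cases hj : hB.isHermitian.eigenvalues j = 0
  · simp [spectralOverlap_mul_eigenvalues_eq_zero hA hB hc hAB hj i]
  · refine Tendsto.const_mul _ (Tendsto.log ?_ hj)
    have : Continuous fun s : ℝ =>
      hB.isHermitian.eigenvalues j + s * hA.isHermitian.eigenvalues i := by fun_prop
    simpa using this.tendsto 0

theorem tendsto_logForm_sub_atTop {A B : Matrix n n ℂ} (hA : A.PosSemidef) (hB : B.PosSemidef) :
    Tendsto (fun s => logForm hA.isHermitian hB.isHermitian s - A.trace.re * Real.log s) atTop
      (𝓝 ((A * matLog A).trace).re) := by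
  rw [re_trace_mul_matLog_self hA.isHermitian hB.isHermitian,
    re_trace_eq_sum_spectralOverlap hA.isHermitian hB.isHermitian]
  simp only [logForm, Finset.sum_mul, ← Finset.sum_sub_distrib]
  refine tendsto_finsetSum _ fun j _ => tendsto_finsetSum _ fun i _ => ?_
  have hp := hA.eigenvalues_nonneg i
  have hq := hB.eigenvalues_nonneg j
  set p := hA.isHermitian.eigenvalues i
  set q := hB.isHermitian.eigenvalues j
  rcases hp.eq_or_lt with h0 | hp
  · simp [← h0]
  · have hlim : Tendsto (fun s : ℝ => spectralOverlap hA.isHermitian hB.isHermitian j i *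
        (p * Real.log (q / s + p))) atTop
        (𝓝 (spectralOverlap hA.isHermitian hB.isHermitian j i * (p * Real.log p))) := by
      refine Tendsto.const_mul _ (Tendsto.const_mul _ (Tendsto.log ?_ hp.ne'))
      simpa using (tendsto_const_nhds (x := q)).div_atTop tendsto_id |>.add_const p
    refine hlim.congr' ?_
    filter_upwards [eventually_gt_atTop 0] with s hs
    have h : q + s * p = s * (q / s + p) := by field_simp
    have hne : q / s + p ≠ 0 := by positivity
    rw [h, Real.log_mul hs.ne' hne]
    ring

end LogForm

section DataProcessing

open Filter Topology

variable {n n' m : Type*} [Fintype n] [DecidableEq n] [Fintype n'] [DecidableEq n'] [Fintype m]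

/-- Monotonicity of the relative entropy under trace-preserving Kraus maps. -/
theorem re_trace_matLog_sub_kraus_le {K : m → Matrix n' n ℂ} (hK : ∑ j, (K j)ᴴ * K j = 1)
    {A B : Matrix n n ℂ} (hA : A.PosSemidef) (hB : B.PosSemidef) {c : ℝ} (hc : 0 < c)
    (hAB : (B - c • A).PosSemidef) :
    ((A * matLog B).trace).re -
      (((∑ j, K j * A * (K j)ᴴ) * matLog (∑ j, K j * B * (K j)ᴴ)).trace).re ≤
    ((A * matLog A).trace).re -
      (((∑ j, K j * A * (K j)ᴴ) * matLog (∑ j, K j * A * (K j)ᴴ)).trace).re := by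
  have hA' := posSemidef_sum_kraus K hA
  have hB' := posSemidef_sum_kraus K hB
  have hAB' : (∑ j, K j * B * (K j)ᴴ - c • ∑ j, K j * A * (K j)ᴴ).PosSemidef := by
    have h := posSemidef_sum_kraus K hAB
    simpa only [Matrix.mul_sub, Matrix.sub_mul, Matrix.mul_smul, Matrix.smul_mul,
      Finset.sum_sub_distrib, ← Finset.smul_sum] using h
  set G : ℝ → ℝ := fun s => logForm hA.isHermitian hB.isHermitian s -
    logForm hA'.isHermitian hB'.isHermitian s with hG
  have hderiv : ∀ s, 0 < s → HasDerivAt G (resolventForm hA.isHermitian hB.isHermitian s -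
      resolventForm hA'.isHermitian hB'.isHermitian s) s := fun s hs =>
    (hasDerivAt_logForm hA hB hs).sub (hasDerivAt_logForm hA' hB' hs)
  have hmono : MonotoneOn G (Set.Ioi 0) := by
    refine monotoneOn_of_deriv_nonneg (convex_Ioi 0)
      (fun s hs => (hderiv s hs).continuousAt.continuousWithinAt) ?_ ?_ <;> rw [interior_Ioi]
    · exact fun s hs => (hderiv s hs).differentiableAt.differentiableWithinAt
    · intro s hs
      rw [(hderiv s hs).deriv, sub_nonneg]
      exact resolventForm_kraus_le hK hA hB hs
  have hzero := (tendsto_logForm_zero hA hB hc hAB).sub (tendsto_logForm_zero hA' hB' hc hAB')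
  have htop : Tendsto G atTop (𝓝 (((A * matLog A).trace).re -
      (((∑ j, K j * A * (K j)ᴴ) * matLog (∑ j, K j * A * (K j)ᴴ)).trace).re)) := by
    refine ((tendsto_logForm_sub_atTop hA hB).sub (tendsto_logForm_sub_atTop hA' hB')).congr ?_
    intro s
    rw [trace_sum_kraus hK, hG]
    ring
  refine le_of_tendsto hzero ?_
  filter_upwards [self_mem_nhdsWithin] with s hs
  refine ge_of_tendsto htop ?_
  filter_upwards [eventually_ge_atTop s] with t ht
  exact hmono hs (lt_of_lt_of_le hs ht) ht

end DataProcessing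

/-- For a CPT map `Φ` in Kraus form, `ρ ↦ S(ρ) - S(Φ(ρ))` is concave on density matrices. -/
theorem entropy_diff_concave {d d' m : ℕ} (K : Fin m → Matrix (Fin d') (Fin d) ℂ)
    (hK : ∑ j, (K j)ᴴ * K j = 1)
    (ρ σ : Matrix (Fin d) (Fin d) ℂ)
    (hρ : ρ.PosSemidef) (hρ1 : ρ.trace = 1)
    (hσ : σ.PosSemidef) (hσ1 : σ.trace = 1)
    (x : ℝ) (hx0 : 0 ≤ x) (hx1 : x ≤ 1) :
    x * (vNEnt ρ - vNEnt (∑ j, K j * ρ * (K j)ᴴ)) +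
      (1 - x) * (vNEnt σ - vNEnt (∑ j, K j * σ * (K j)ᴴ)) ≤
    vNEnt (x • ρ + (1 - x) • σ) -
      vNEnt (∑ j, K j * (x • ρ + (1 - x) • σ) * (K j)ᴴ) := by
  rcases hx0.eq_or_lt with rfl | hx0
  · simp
  rcases hx1.eq_or_lt with rfl | hx1
  · simp
  have hy0 : 0 < 1 - x := sub_pos.2 hx1
  set ω := x • ρ + (1 - x) • σ with hω
  have hωpos : ω.PosSemidef := (hρ.smul hx0.le).add (hσ.smul hy0.le)
  have h1 := re_trace_matLog_sub_kraus_le hK hρ hωpos hx0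
    (by rw [hω, add_sub_cancel_left]; exact hσ.smul hy0.le)
  have h2 := re_trace_matLog_sub_kraus_le hK hσ hωpos hy0
    (by rw [hω, add_sub_cancel_right]; exact hρ.smul hx0.le)
  have e1 : ((ω * matLog ω).trace).re =
      x * ((ρ * matLog ω).trace).re + (1 - x) * ((σ * matLog ω).trace).re := by
    have h : ∀ L : Matrix (Fin d) (Fin d) ℂ, ((ω * L).trace).re =
        x * ((ρ * L).trace).re + (1 - x) * ((σ * L).trace).re := fun L => by
      rw [hω, Matrix.add_mul, Matrix.smul_mul, Matrix.smul_mul, Matrix.trace_add,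
        Matrix.trace_smul, Matrix.trace_smul, Complex.add_re, Complex.smul_re, Complex.smul_re,
        smul_eq_mul, smul_eq_mul]
    exact h _
  have e2 : (((∑ j, K j * ω * (K j)ᴴ) * matLog (∑ j, K j * ω * (K j)ᴴ)).trace).re =
      x * (((∑ j, K j * ρ * (K j)ᴴ) * matLog (∑ j, K j * ω * (K j)ᴴ)).trace).re +
      (1 - x) * (((∑ j, K j * σ * (K j)ᴴ) * matLog (∑ j, K j * ω * (K j)ᴴ)).trace).re := by
    have hlin : ∑ j, K j * ω * (K j)ᴴ =
        x • ∑ j, K j * ρ * (K j)ᴴ + (1 - x) • ∑ j, K j * σ * (K j)ᴴ := by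
      simp only [hω, Matrix.mul_add, Matrix.add_mul, Matrix.mul_smul, Matrix.smul_mul,
        Finset.sum_add_distrib, Finset.smul_sum]
    have h : ∀ L : Matrix (Fin d') (Fin d') ℂ, (((∑ j, K j * ω * (K j)ᴴ) * L).trace).re =
        x * (((∑ j, K j * ρ * (K j)ᴴ) * L).trace).re +
        (1 - x) * (((∑ j, K j * σ * (K j)ᴴ) * L).trace).re := fun L => by
      rw [hlin, Matrix.add_mul, Matrix.smul_mul, Matrix.smul_mul, Matrix.trace_add,
        Matrix.trace_smul, Matrix.trace_smul, Complex.add_re, Complex.smul_re, Complex.smul_re,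
        smul_eq_mul, smul_eq_mul]
    exact h _
  have h1' := mul_le_mul_of_nonneg_left h1 hx0.le
  have h2' := mul_le_mul_of_nonneg_left h2 hy0.le
  simp only [vNEnt, e1, e2]
  linarith
end
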